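/- arXiv:2406.12021 — 5 statements merged into one kernel-verified Lean document; each statement's English description precedes it below -/
import Mathlib

section
/- Let A be a real m×n matrix, B a real m×p matrix, and let I≤ and I= be disjoint sets of row indices with I≤ ∪ I= = {1,…,m}. If the feasible region Ω = {X ∈ ℝ^{n×p} : (AX)_{ij} ≤ B_{ij} for all i ∈ I≤ and all j, and (AX)_{ij} = B_{ij} for all i ∈ I= and all j} is nonempty, then there exists a constant L > 0 such that for every X ∈ ℝ^{n×p}, d(X,Ω) ≤ L·‖c_M(AX − B)‖_F. -/
open Finset

/-- Frobenius norm of a real matrix. -/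
noncomputable def frob {a b : ℕ} (M : Matrix (Fin a) (Fin b) ℝ) : ℝ :=
  Real.sqrt (∑ i, ∑ j, (M i j) ^ 2)

/-- Distance (w.r.t. Frobenius norm) of a matrix to a set of matrices. -/
noncomputable def mdist {a b : ℕ} (X : Matrix (Fin a) (Fin b) ℝ)
    (Ω : Set (Matrix (Fin a) (Fin b) ℝ)) : ℝ :=
  sInf ((fun Y => frob (X - Y)) '' Ω)

/-- Two families of reals with every lower bound at most every upper bound, which moreover are
compatible with the interval `[c - d, c + d]`, are separated by a point of that interval. -/
theorem exists_mem_Icc_separating {α β : Type*} (l : α → ℝ) (u : β → ℝ) {c d : ℝ} (hd : 0 ≤ d)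
    (hlu : ∀ i j, l i ≤ u j) (hl : ∀ i, l i ≤ c + d) (hu : ∀ j, c - d ≤ u j) :
    ∃ z, (∀ i, l i ≤ z) ∧ (∀ j, z ≤ u j) ∧ |c - z| ≤ d := by
  have hbdd : BddAbove (insert (c - d) (Set.range l)) := by
    refine ⟨c + d, ?_⟩
    rintro _ (rfl | ⟨i, rfl⟩)
    · linarith
    · exact hl i
  have hle : ∀ v, c - d ≤ v → (∀ i, l i ≤ v) → sSup (insert (c - d) (Set.range l)) ≤ v := by
    intro v h h'
    refine csSup_le (Set.insert_nonempty _ _) ?_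
    rintro _ (rfl | ⟨i, rfl⟩)
    · exact h
    · exact h' i
  refine ⟨sSup (insert (c - d) (Set.range l)), fun i => le_csSup hbdd (Or.inr ⟨i, rfl⟩),
    fun j => hle _ (hu j) fun i => hlu i j, abs_le.2 ⟨?_, ?_⟩⟩
  · linarith [hle (c + d) (by linarith) hl]
  · linarith [le_csSup hbdd (Or.inl rfl)]

theorem exists_nonneg_forall_le {ι : Type*} [Finite ι] (f : ι → ℝ) :
    ∃ M, 0 ≤ M ∧ ∀ i, f i ≤ M := by
  obtain ⟨M, hM⟩ := (Set.finite_range f).bddAbove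
  exact ⟨max M 0, le_max_right _ _, fun i => (hM ⟨i, rfl⟩).trans (le_max_left _ _)⟩

theorem dotProduct_le_add_of_abs_sub_le {n : ℕ} (a x y : Fin n → ℝ) {d : ℝ}
    (h : ∀ k, |x k - y k| ≤ d) : a ⬝ᵥ y ≤ a ⬝ᵥ x + (∑ k, |a k|) * d := by
  rw [← sub_le_iff_le_add', ← dotProduct_sub, dotProduct, Finset.sum_mul]
  refine Finset.sum_le_sum fun k _ => (le_abs_self _).trans ?_
  rw [abs_mul, Pi.sub_apply, abs_sub_comm]
  exact mul_le_mul_of_nonneg_left (h k) (abs_nonneg _)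

/-- **Hoffman's bound** for a finite system of linear inequalities, in the sup norm. The proof
eliminates one variable at a time (Fourier–Motzkin). -/
theorem hoffman_inequalities {n : ℕ} {ι : Type} [Finite ι] (a : ι → Fin n → ℝ) (b : ι → ℝ)
    (hfeas : ∃ x, ∀ i, a i ⬝ᵥ x ≤ b i) :
    ∃ L, 0 ≤ L ∧ ∀ x r, 0 ≤ r → (∀ i, a i ⬝ᵥ x ≤ b i + r) →
      ∃ y, (∀ i, a i ⬝ᵥ y ≤ b i) ∧ ∀ k, |x k - y k| ≤ L * r := by
  induction n generalizing ι with
  | zero =>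
    obtain ⟨y, hy⟩ := hfeas
    exact ⟨0, le_rfl, fun x r _ _ => ⟨y, hy, fun k => k.elim0⟩⟩
  | succ n ih =>
    have hsplit : ∀ i x, a i ⬝ᵥ x = a i 0 * x 0 + Fin.tail (a i) ⬝ᵥ Fin.tail x := fun i x => by
      simp [dotProduct, Fin.sum_univ_succ, Fin.tail]
    let κ := {q : ι × ι // 0 < a q.1 0 ∧ a q.2 0 < 0} ⊕ {i : ι // a i 0 = 0}
    let a' : κ → Fin n → ℝ := Sum.elim
      (fun q => (-a q.1.2 0) • Fin.tail (a q.1.1) + a q.1.1 0 • Fin.tail (a q.1.2))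
      (fun i => Fin.tail (a i))
    let b' : κ → ℝ := Sum.elim (fun q => (-a q.1.2 0) * b q.1.1 + a q.1.1 0 * b q.1.2)
      (fun i => b i)
    obtain ⟨C, hC, hCle⟩ := exists_nonneg_forall_le (Sum.elim
      (fun q => -a q.1.2 0 + a q.1.1 0) (fun _ => 1) : κ → ℝ)
    have hproj : ∀ x r, 0 ≤ r → (∀ i, a i ⬝ᵥ x ≤ b i + r) →
        ∀ k, a' k ⬝ᵥ Fin.tail x ≤ b' k + C * r := by
      rintro x r hr hx (⟨⟨i, j⟩, hi, hj⟩ | ⟨i, hi⟩)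
      · have hc : (-a j 0 + a i 0) * r ≤ C * r :=
          mul_le_mul_of_nonneg_right (hCle (Sum.inl ⟨⟨i, j⟩, hi, hj⟩)) hr
        have h1 := hx i
        have h2 := hx j
        simp only [hsplit] at h1 h2
        simp only [a', b', Sum.elim_inl, add_dotProduct, smul_dotProduct, smul_eq_mul]
        simp only at hi hj
        have h3 := mul_le_mul_of_nonneg_left h1 (neg_pos.2 hj).le
        have h4 := mul_le_mul_of_nonneg_left h2 hi.le
        linarith
      · have hc : 1 * r ≤ C * r :=
          mul_le_mul_of_nonneg_right (hCle (Sum.inr ⟨i, hi⟩)) hr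
        have h1 := hx i
        rw [hsplit, hi] at h1
        simp only [a', b', Sum.elim_inr]
        linarith
    obtain ⟨L, hL, hLx⟩ := ih a' b' (by
      obtain ⟨x, hx⟩ := hfeas
      refine ⟨Fin.tail x, fun k => ?_⟩
      simpa using hproj x 0 le_rfl (by simpa using hx) k)
    obtain ⟨M, hM, hMle⟩ := exists_nonneg_forall_le
      fun i => (1 + (∑ k, |Fin.tail (a i) k|) * (L * C)) / |a i 0|
    refine ⟨max (L * C) M, le_max_of_le_right hM, fun x r hr hx => ?_⟩
    obtain ⟨y, hy, hxy⟩ := hLx (Fin.tail x) (C * r) (by positivity) (hproj x r hr hx)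
    have hres : ∀ i, a i 0 ≠ 0 →
        a i 0 * x 0 + Fin.tail (a i) ⬝ᵥ y ≤ b i + |a i 0| * (M * r) := by
      intro i hi
      have h1 := hx i
      rw [hsplit] at h1
      have h2 := dotProduct_le_add_of_abs_sub_le (Fin.tail (a i)) _ _ hxy
      have h3 := mul_le_mul_of_nonneg_right
        ((div_le_iff₀ (abs_pos.2 hi)).1 (hMle i)) hr
      linarith
    obtain ⟨z, hlz, hzu, hz⟩ := exists_mem_Icc_separating (c := x 0) (d := M * r)
      (fun j : {j // a j 0 < 0} => (b j - Fin.tail (a j) ⬝ᵥ y) / a j 0)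
      (fun i : {i // 0 < a i 0} => (b i - Fin.tail (a i) ⬝ᵥ y) / a i 0) (by positivity)
      (by
        rintro ⟨j, hj⟩ ⟨i, hi⟩
        have h := hy (Sum.inl ⟨⟨i, j⟩, hi, hj⟩)
        simp only [a', b', Sum.elim_inl, add_dotProduct, smul_dotProduct, smul_eq_mul] at h
        rw [div_le_iff_of_neg hj, div_mul_eq_mul_div, div_le_iff₀ hi]
        linarith)
      (by
        rintro ⟨j, hj⟩
        have h := hres j hj.ne
        rw [abs_of_neg hj] at h
        rw [div_le_iff_of_neg hj]
        linarith)
      (by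
        rintro ⟨i, hi⟩
        have h := hres i hi.ne'
        rw [abs_of_pos hi] at h
        rw [le_div_iff₀ hi]
        linarith)
    refine ⟨Fin.cons z y, fun i => ?_, Fin.cases ?_ fun k => ?_⟩
    · rw [hsplit, Fin.cons_zero, Fin.tail_cons]
      rcases lt_trichotomy (a i 0) 0 with hi | hi | hi
      · have h := hlz ⟨i, hi⟩
        rw [div_le_iff_of_neg hi] at h
        linarith
      · have h : Fin.tail (a i) ⬝ᵥ y ≤ b i := hy (Sum.inr ⟨i, hi⟩)
        rw [hi]
        linarith
      · have h := hzu ⟨i, hi⟩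
        rw [le_div_iff₀ hi] at h
        linarith
    · exact hz.trans (mul_le_mul_of_nonneg_right (le_max_right _ _) hr)
    · have h := hxy k
      rw [← mul_assoc] at h
      exact h.trans (mul_le_mul_of_nonneg_right (le_max_left _ _) hr)

theorem frob_nonneg {a b : ℕ} (M : Matrix (Fin a) (Fin b) ℝ) : 0 ≤ frob M :=
  Real.sqrt_nonneg _

theorem abs_apply_le_frob {a b : ℕ} (M : Matrix (Fin a) (Fin b) ℝ) (i : Fin a) (j : Fin b) :
    |M i j| ≤ frob M := by
  refine Real.abs_le_sqrt ?_
  calc (M i j) ^ 2 ≤ ∑ j, (M i j) ^ 2 :=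
        Finset.single_le_sum (f := fun j => (M i j) ^ 2) (fun _ _ => sq_nonneg _)
          (Finset.mem_univ j)
    _ ≤ ∑ i, ∑ j, (M i j) ^ 2 :=
        Finset.single_le_sum (f := fun i => ∑ j, (M i j) ^ 2)
          (fun _ _ => Finset.sum_nonneg fun _ _ => sq_nonneg _) (Finset.mem_univ i)

theorem frob_le_of_abs_apply_le {a b : ℕ} (M : Matrix (Fin a) (Fin b) ℝ) {d : ℝ} (hd : 0 ≤ d)
    (h : ∀ i j, |M i j| ≤ d) : frob M ≤ Real.sqrt (a * b) * d := by
  refine Real.sqrt_le_iff.2 ⟨by positivity, ?_⟩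
  rw [mul_pow, Real.sq_sqrt (by positivity)]
  calc ∑ i, ∑ j, (M i j) ^ 2 ≤ ∑ _i : Fin a, ∑ _j : Fin b, d ^ 2 :=
        Finset.sum_le_sum fun i _ => Finset.sum_le_sum fun j _ =>
          sq_le_sq.2 ((h i j).trans (le_abs_self d))
    _ = a * b * d ^ 2 := by simp [mul_assoc]

theorem mdist_le_frob_sub {a b : ℕ} (X : Matrix (Fin a) (Fin b) ℝ)
    {Ω : Set (Matrix (Fin a) (Fin b) ℝ)} {Y : Matrix (Fin a) (Fin b) ℝ} (hY : Y ∈ Ω) :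
    mdist X Ω ≤ frob (X - Y) := by
  refine csInf_le ⟨0, ?_⟩ ⟨Y, hY, rfl⟩
  rintro _ ⟨Z, -, rfl⟩
  exact frob_nonneg _

/-- Hoffman bound for matrix linear feasibility systems (Lemma 3.1). -/
theorem hoffman_matrix {m n p : ℕ}
    (A : Matrix (Fin m) (Fin n) ℝ) (B : Matrix (Fin m) (Fin p) ℝ)
    (Ile Ieq : Finset (Fin m)) (hdisj : Disjoint Ile Ieq)
    (hunion : Ile ∪ Ieq = Finset.univ)
    (Ω : Set (Matrix (Fin n) (Fin p) ℝ))
    (hΩ : Ω = {X | (∀ i ∈ Ile, ∀ j, (A * X) i j ≤ B i j) ∧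
                   (∀ i ∈ Ieq, ∀ j, (A * X) i j = B i j)})
    (hne : Ω.Nonempty) :
    ∃ L > 0, ∀ X : Matrix (Fin n) (Fin p) ℝ,
      mdist X Ω ≤ L * frob (Matrix.of fun i j =>
        if i ∈ Ile then max ((A * X - B) i j) 0 else (A * X - B) i j) := by
  let a : Fin m ⊕ {i // i ∈ Ieq} → Fin n → ℝ := Sum.elim (fun i => A i) (fun i => -A i)
  let b : Fin p → Fin m ⊕ {i // i ∈ Ieq} → ℝ := fun j =>
    Sum.elim (fun i => B i j) (fun i => -B i j)
  have hmul : ∀ (X : Matrix (Fin n) (Fin p) ℝ) i j, (A * X) i j = A i ⬝ᵥ fun k => X k j :=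
    fun _ _ _ => rfl
  have hmem : ∀ X, X ∈ Ω ↔ ∀ j k, a k ⬝ᵥ (fun l => X l j) ≤ b j k := by
    intro X
    have hcover : ∀ i, i ∈ Ile ∨ i ∈ Ieq := fun i => by
      rw [← Finset.mem_union, hunion]
      exact Finset.mem_univ i
    simp only [hΩ, Set.mem_ofPred_eq, Sum.forall, a, b, Sum.elim_inl, Sum.elim_inr,
      neg_dotProduct, neg_le_neg_iff, Subtype.forall, ← hmul]
    constructor
    · rintro ⟨h1, h2⟩ j
      exact ⟨fun i => (hcover i).elim (fun hi => h1 i hi j) fun hi => (h2 i hi j).le,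
        fun i hi => (h2 i hi j).ge⟩
    · exact fun h => ⟨fun i _ j => (h j).1 i, fun i hi j => le_antisymm ((h j).1 i) ((h j).2 i hi)⟩
  obtain ⟨X₀, hX₀⟩ := hne
  choose L _ hLx using fun j =>
    hoffman_inequalities a (b j) ⟨fun k => X₀ k j, (hmem X₀).1 hX₀ j⟩
  obtain ⟨K, hK, hLK⟩ := exists_nonneg_forall_le L
  refine ⟨Real.sqrt (n * p) * K + 1, by positivity, fun X => ?_⟩
  set R : Matrix (Fin m) (Fin p) ℝ := Matrix.of fun i j =>
    if i ∈ Ile then max ((A * X - B) i j) 0 else (A * X - B) i j with hR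
  have hr := frob_nonneg R
  have hres : ∀ j k, a k ⬝ᵥ (fun l => X l j) ≤ b j k + frob R := by
    rintro j (i | ⟨i, hi⟩)
    · have h := (le_abs_self _).trans (abs_apply_le_frob R i j)
      have h' : (A * X) i j - B i j ≤ R i j := by
        rw [hR, Matrix.of_apply]
        split_ifs
        · exact le_max_left _ _
        · exact le_rfl
      simp only [a, b, Sum.elim_inl, ← hmul]
      linarith
    · have h := (neg_le_abs _).trans (abs_apply_le_frob R i j)
      have h' : R i j = (A * X) i j - B i j := by
        rw [hR, Matrix.of_apply, if_neg (Finset.disjoint_right.1 hdisj hi), Matrix.sub_apply]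
      simp only [a, b, Sum.elim_inr, neg_dotProduct, ← hmul]
      linarith
  choose y hy hxy using fun j => hLx j (fun l => X l j) (frob R) hr (hres j)
  have hY : (Matrix.of fun k j => y j k) ∈ Ω := (hmem _).2 hy
  calc mdist X Ω ≤ frob (X - Matrix.of fun k j => y j k) := mdist_le_frob_sub X hY
    _ ≤ Real.sqrt (n * p) * (K * frob R) :=
        frob_le_of_abs_apply_le _ (by positivity) fun k j =>
          (hxy j k).trans (mul_le_mul_of_nonneg_right (hLK j) hr)
    _ ≤ (Real.sqrt (n * p) * K + 1) * frob R := by linarith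
end

section
/- Let a_1,…,a_m ∈ ℝ^N, b ∈ ℝ^m, and let I≤ and I= be disjoint index sets with I≤ ∪ I= = {1,…,m}, such that the feasible region Ω = {x ∈ ℝ^N : ⟨a_i, x⟩ ≤ b_i for i ∈ I≤, ⟨a_i, x⟩ = b_i for i ∈ I=} is nonempty. Let x ∉ Ω and let y ∈ Ω be the (unique) nearest point of Ω to x. Define S = {i ∈ I≤ : ⟨a_i, y⟩ = b_i} and Ω_S = {z ∈ ℝ^N : ⟨a_i, z⟩ ≤ b_i for i ∈ S, ⟨a_i, z⟩ = b_i for i ∈ I=}. Then x ∉ Ω_S, and y is also a nearest point of Ω_S to x, i.e., y ∈ Ω_S and ‖x − y‖ ≤ ‖x − z‖ for all z ∈ Ω_S. -/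
open Finset
open scoped RealInnerProductSpace

/-- Lemma 4.1 (vectorized form): the projection of `x` onto the feasible region `Ω`
is also a nearest point of the relaxed region `Ω_S` determined by the active
inequality constraints, and `x ∉ Ω_S`. -/
theorem projection_onto_active_set {m N : ℕ}
    (a : Fin m → EuclideanSpace ℝ (Fin N)) (b : Fin m → ℝ)
    (Ile Ieq : Finset (Fin m)) (hdisj : Disjoint Ile Ieq)
    (hunion : Ile ∪ Ieq = Finset.univ)
    (Ω : Set (EuclideanSpace ℝ (Fin N)))
    (hΩ : Ω = {x | (∀ i ∈ Ile, ⟪a i, x⟫ ≤ b i) ∧ ∀ i ∈ Ieq, ⟪a i, x⟫ = b i})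
    (hne : Ω.Nonempty)
    (x : EuclideanSpace ℝ (Fin N)) (hx : x ∉ Ω)
    (y : EuclideanSpace ℝ (Fin N)) (hy : y ∈ Ω)
    (hymin : ∀ z ∈ Ω, ‖x - y‖ ≤ ‖x - z‖)
    (S : Finset (Fin m)) (hS : ∀ i, i ∈ S ↔ i ∈ Ile ∧ ⟪a i, y⟫ = b i)
    (ΩS : Set (EuclideanSpace ℝ (Fin N)))
    (hΩS : ΩS = {z | (∀ i ∈ S, ⟪a i, z⟫ ≤ b i) ∧ ∀ i ∈ Ieq, ⟪a i, z⟫ = b i}) :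
    x ∉ ΩS ∧ y ∈ ΩS ∧ ∀ z ∈ ΩS, ‖x - y‖ ≤ ‖x - z‖ := by
  subst hΩ hΩS
  simp only [Set.mem_ofPred_eq] at hx hy hymin ⊢
  have hconv : Convex ℝ {z | (∀ i ∈ S, ⟪a i, z⟫ ≤ b i) ∧ ∀ i ∈ Ieq, ⟪a i, z⟫ = b i} := by
    simp only [Set.ofPred_and, Set.ofPred_forall]
    exact (convex_iInter₂ fun i _ => convex_halfSpace_le (innerₛₗ ℝ (a i)).isLinear (b i)).inter
      (convex_iInter₂ fun i _ => convex_hyperplane (innerₛₗ ℝ (a i)).isLinear (b i))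
  have hyS : y ∈ {z | (∀ i ∈ S, ⟪a i, z⟫ ≤ b i) ∧ ∀ i ∈ Ieq, ⟪a i, z⟫ = b i} :=
    ⟨fun i hi => ((hS i).1 hi).2.le, hy.2⟩
  -- Inequality constraints that are inactive at `y` remain satisfied near `y`.
  have hinactive : ∀ᶠ z in nhds y, ∀ i ∈ Ile, i ∉ S → ⟪a i, z⟫ ≤ b i := by
    refine (Finset.eventually_all Ile).2 fun i hi => ?_
    by_cases hiS : i ∈ S
    · exact .of_forall fun z h => absurd hiS h
    · have hlt : ⟪a i, y⟫ < b i := (hy.1 i hi).lt_of_ne fun h => hiS ((hS i).2 ⟨hi, h⟩)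
      have hcont : ContinuousAt (fun z => ⟪a i, z⟫) y := by fun_prop
      exact (hcont.eventually_lt_const hlt).mono fun z hz _ => hz.le
  have hmin : ∀ z ∈ {z | (∀ i ∈ S, ⟪a i, z⟫ ≤ b i) ∧ ∀ i ∈ Ieq, ⟪a i, z⟫ = b i},
      ‖x - y‖ ≤ ‖x - z‖ := by
    have hloc : IsLocalMinOn (fun z => dist z x)
        {z | (∀ i ∈ S, ⟪a i, z⟫ ≤ b i) ∧ ∀ i ∈ Ieq, ⟪a i, z⟫ = b i} y := by
      refine eventually_nhdsWithin_iff.2 (hinactive.mono fun z hz hzS => ?_)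
      simp only [dist_eq_norm']
      refine hymin z ⟨fun i hi => ?_, hzS.2⟩
      by_cases hiS : i ∈ S
      · exact hzS.1 i hiS
      · exact hz i hi hiS
    intro z hz
    simpa only [dist_eq_norm', Set.mem_ofPred_eq] using
      IsMinOn.of_isLocalMinOn_of_convexOn hyS hloc (convexOn_dist x hconv) hz
  refine ⟨fun hxS => hx ?_, hyS, hmin⟩
  have hxy : x = y := by
    have h := hmin x hxS
    rwa [sub_self, norm_zero, norm_le_zero_iff, sub_eq_zero] at h
  exact hxy ▸ hy
end

section
/- Let a_1,…,a_m ∈ ℝ^N and let S and I= be disjoint subsets of {1,…,m}. Define the closed convex cone C = {z ∈ ℝ^N : ⟨a_i, z⟩ ≤ 0 for i ∈ S, ⟨a_i, z⟩ = 0 for i ∈ I=} and the set E = {z ∈ ℝ^N : z ∉ C and the nearest point of C to z is 0}. Then there exists a constant γ > 0 such that ‖c_S(Az)‖ ≥ γ‖z‖ for all z ∈ E, where A is the m×N matrix with rows a_1ᵀ,…,a_mᵀ. -/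
open Finset
open scoped RealInnerProductSpace

/-- A continuous, positively homogeneous function which is positive on the nonzero points of a
closed set stable under positive scaling is bounded below there by a positive multiple of the
norm. -/
theorem exists_pos_mul_norm_le_of_homogeneous {V : Type*} [NormedAddCommGroup V]
    [NormedSpace ℝ V] [ProperSpace V] {f : V → ℝ} (hf : Continuous f)
    (hhom : ∀ t : ℝ, 0 < t → ∀ z, f (t • z) = t * f z) {K : Set V} (hK : IsClosed K)
    (hscale : ∀ t : ℝ, 0 < t → ∀ z ∈ K, t • z ∈ K) (hpos : ∀ z ∈ K, z ≠ 0 → 0 < f z) :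
    ∃ γ > 0, ∀ z ∈ K, z ≠ 0 → γ * ‖z‖ ≤ f z := by
  have hcomp : IsCompact (Metric.sphere (0 : V) 1 ∩ K) := (isCompact_sphere 0 1).inter_right hK
  obtain ⟨γ, hγ, hmin⟩ := hcomp.exists_forall_le' hf.continuousOn (a := 0) fun z hz =>
    hpos z hz.2 (ne_zero_of_mem_unit_sphere ⟨z, hz.1⟩)
  refine ⟨γ, hγ, fun z hz hz0 => ?_⟩
  have hn : 0 < ‖z‖ := norm_pos_iff.2 hz0
  have h := hmin (‖z‖⁻¹ • z)
    ⟨by simp [norm_smul, hn.ne'], hscale _ (inv_pos.2 hn) z hz⟩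
  rwa [hhom _ (inv_pos.2 hn), inv_mul_eq_div, le_div_iff₀ hn] at h

/-- Lemma 4.2: on the set `E` of points outside the cone `C` whose nearest point
in `C` is the origin, `‖c_S(Az)‖` is bounded below by a positive multiple of `‖z‖`. -/
theorem cone_residual_lower_bound {m N : ℕ}
    (a : Fin m → EuclideanSpace ℝ (Fin N))
    (S Ieq : Finset (Fin m)) (hdisj : Disjoint S Ieq)
    (C : Set (EuclideanSpace ℝ (Fin N)))
    (hC : C = {z | (∀ i ∈ S, ⟪a i, z⟫ ≤ 0) ∧ ∀ i ∈ Ieq, ⟪a i, z⟫ = 0})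
    (E : Set (EuclideanSpace ℝ (Fin N)))
    (hE : E = {z | z ∉ C ∧ ∀ c ∈ C, ‖z‖ ≤ ‖z - c‖}) :
    ∃ γ > 0, ∀ z ∈ E,
      Real.sqrt (∑ i, (if i ∈ S then max ⟪a i, z⟫ 0
          else if i ∈ Ieq then ⟪a i, z⟫ else 0) ^ 2) ≥ γ * ‖z‖ := by
  have hCsmul : ∀ t : ℝ, 0 < t → ∀ c ∈ C, t • c ∈ C := by
    subst hC
    rintro t ht c ⟨h1, h2⟩
    refine ⟨fun i hi => ?_, fun i hi => ?_⟩
    · rw [real_inner_smul_right]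
      exact mul_nonpos_of_nonneg_of_nonpos ht.le (h1 i hi)
    · rw [real_inner_smul_right, h2 i hi, mul_zero]
  have h0 : (0 : EuclideanSpace ℝ (Fin N)) ∈ C := by simp [hC]
  refine Exists.elim (exists_pos_mul_norm_le_of_homogeneous
    (f := fun z => Real.sqrt (∑ i, (if i ∈ S then max ⟪a i, z⟫ 0
          else if i ∈ Ieq then ⟪a i, z⟫ else 0) ^ 2))
    (K := {z | ∀ c ∈ C, ‖z‖ ≤ ‖z - c‖}) ?_ ?_ ?_ ?_ ?_) ?_
  rotate_right
  · rintro γ ⟨hγ, h⟩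
    refine ⟨γ, hγ, fun z hz => ?_⟩
    rw [hE] at hz
    exact h z hz.2 fun hz0 => hz.1 (hz0 ▸ h0)
  · refine Real.continuous_sqrt.comp (continuous_finsetSum _ fun i _ => ?_)
    split_ifs <;> fun_prop
  · intro t ht z
    have hsum : (∑ i, (if i ∈ S then max ⟪a i, t • z⟫ 0
          else if i ∈ Ieq then ⟪a i, t • z⟫ else 0) ^ 2) =
        t ^ 2 * ∑ i, (if i ∈ S then max ⟪a i, z⟫ 0
          else if i ∈ Ieq then ⟪a i, z⟫ else 0) ^ 2 := by
      rw [Finset.mul_sum]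
      refine Finset.sum_congr rfl fun i _ => ?_
      rw [← mul_pow, real_inner_smul_right]
      congr 1
      split_ifs
      · rw [mul_max_of_nonneg _ _ ht.le, mul_zero]
      · rfl
      · rw [mul_zero]
    simp only [hsum]
    rw [Real.sqrt_mul (sq_nonneg t), Real.sqrt_sq ht.le]
  · simp only [Set.ofPred_forall]
    exact isClosed_biInter fun c _ => isClosed_le (by fun_prop) (by fun_prop)
  · intro t ht z hz c hc
    have hle := hz _ (hCsmul t⁻¹ (inv_pos.2 ht) c hc)
    have heq : t • z - c = t • (z - t⁻¹ • c) := by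
      rw [smul_sub, smul_inv_smul₀ ht.ne']
    rw [heq, norm_smul, norm_smul]
    gcongr
  · intro z hz hz0
    have hzC : z ∉ C := fun hmem => hz0 (by simpa using hz z hmem)
    refine Real.sqrt_pos.2 (lt_of_le_of_ne (Finset.sum_nonneg fun i _ => sq_nonneg _) ?_)
    intro hsum
    have hzero := (Finset.sum_eq_zero_iff_of_nonneg fun i _ => sq_nonneg _).1 hsum.symm
    refine hzC ?_
    rw [hC]
    refine ⟨fun i hi => ?_, fun i hi => ?_⟩
    · simpa [hi] using hzero i (Finset.mem_univ i)
    · simpa [hi, Finset.disjoint_right.1 hdisj hi] using hzero i (Finset.mem_univ i)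
end

section
/- Let 𝒜 be a real tensor of size m×l×n, ℬ of size m×p×n, and let I≤ and I= be disjoint sets of row indices with I≤ ∪ I= = {1,…,m}. Suppose the feasible region Ω = {𝒳 of size l×p×n : (𝒜∗𝒳)(i,q,k) ≤ ℬ(i,q,k) for all i ∈ I≤ and all q,k, and (𝒜∗𝒳)(i,q,k) = ℬ(i,q,k) for all i ∈ I= and all q,k} is nonempty. Then there exists a constant γ > 0 such that for every tensor 𝒳 of size l×p×n, d(𝒳, Ω) ≤ γ·‖c_T(𝒜∗𝒳 − ℬ)‖_F. -/
open Finset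

/-- The t-product of an `m×l×n` tensor with an `l×p×n` tensor. -/
noncomputable def tProd {m l p n : ℕ} [NeZero n]
    (A : Fin m → Fin l → ZMod n → ℝ) (X : Fin l → Fin p → ZMod n → ℝ) :
    Fin m → Fin p → ZMod n → ℝ :=
  fun i q k => ∑ j, ∑ s, A i j s * X j q (k - s)

/-- Frobenius norm of a third-order tensor. -/
noncomputable def tfrob {a b n : ℕ} [NeZero n] (X : Fin a → Fin b → ZMod n → ℝ) : ℝ :=
  Real.sqrt (∑ i, ∑ j, ∑ k, (X i j k) ^ 2)

/-- Distance (w.r.t. the Frobenius norm) of a tensor to a set of tensors. -/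
noncomputable def tdist {a b n : ℕ} [NeZero n] (X : Fin a → Fin b → ZMod n → ℝ)
    (Ω : Set (Fin a → Fin b → ZMod n → ℝ)) : ℝ :=
  sInf ((fun Y => tfrob (fun i j k => X i j k - Y i j k)) '' Ω)

/-- Every feasible finite system of linear inequalities on `E` admits a Hoffman error bound:
a point violating each inequality by at most `r` lies within `γ * r` of a feasible point. -/
def HasHoffmanBound (E : Type*) [NormedAddCommGroup E] [NormedSpace ℝ E] : Prop :=
  ∀ (ι : Type) [Finite ι] (a : ι → E →L[ℝ] ℝ) (b : ι → ℝ), (∃ x, ∀ i, a i x ≤ b i) →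
    ∃ γ : ℝ, 0 ≤ γ ∧ ∀ (x : E) (r : ℝ), 0 ≤ r → (∀ i, a i x ≤ b i + r) →
      ∃ y, (∀ i, a i y ≤ b i) ∧ ‖x - y‖ ≤ γ * r

theorem exists_forall_le_of_finite {ι : Type*} [Finite ι] (f : ι → ℝ) :
    ∃ K : ℝ, 0 ≤ K ∧ ∀ i, f i ≤ K := by
  obtain ⟨K, hK⟩ := Set.Finite.bddAbove (Set.finite_range f)
  exact ⟨max K 0, le_max_right _ _, fun i => (hK ⟨i, rfl⟩).trans (le_max_left _ _)⟩

/-- The one-dimensional Hoffman bound, with feasibility expressed through pairs of inequalities. -/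
theorem exists_mul_le_and_abs_sub_le {ι : Type*} (c s : ι → ℝ) {M ρ t : ℝ} (hM : 0 ≤ M)
    (hρ : 0 ≤ ρ) (hMc : ∀ i, |c i|⁻¹ ≤ M) (hzero : ∀ i, c i = 0 → 0 ≤ s i)
    (hpair : ∀ i j, c i < 0 → 0 < c j → 0 ≤ c j * s i - c i * s j)
    (ht : ∀ i, c i * t ≤ s i + ρ) :
    ∃ t', (∀ i, c i * t' ≤ s i) ∧ |t - t'| ≤ M * ρ := by
  have hMρ : 0 ≤ M * ρ := mul_nonneg hM hρ
  have hbound : ∀ i, ρ / |c i| ≤ M * ρ := fun i => by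
    rw [div_eq_inv_mul]
    exact mul_le_mul_of_nonneg_right (hMc i) hρ
  set S : Set ℝ := insert (t - M * ρ) {u | ∃ i, c i < 0 ∧ u = s i / c i}
  have hle : ∀ u ∈ S, u ≤ t + M * ρ := by
    rintro u (rfl | ⟨i, hi, rfl⟩)
    · linarith
    · have h := hbound i
      rw [abs_of_neg hi, div_neg] at h
      have h' : (s i + ρ) / c i ≤ t := (div_le_iff_of_neg hi).2 (by linarith [ht i])
      rw [add_div] at h'
      linarith
  have hbdd : BddAbove S := ⟨_, hle⟩
  have hne : S.Nonempty := ⟨_, Set.mem_insert _ _⟩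
  refine ⟨sSup S, fun i => ?_, ?_⟩
  · rcases lt_trichotomy (c i) 0 with hi | hi | hi
    · have h : s i / c i ≤ sSup S := le_csSup hbdd (Or.inr ⟨i, hi, rfl⟩)
      rw [div_le_iff_of_neg hi] at h
      linarith
    · simpa [hi] using hzero i hi
    · have h : sSup S ≤ s i / c i := by
        refine csSup_le hne ?_
        rintro u (rfl | ⟨j, hj, rfl⟩)
        · have h := hbound i
          rw [abs_of_pos hi] at h
          have h' : t ≤ (s i + ρ) / c i := (le_div_iff₀ hi).2 (by linarith [ht i])
          rw [add_div] at h'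
          linarith
        · rw [div_le_iff_of_neg hj, div_mul_eq_mul_div, div_le_iff₀ hi]
          linarith [hpair j i hj hi]
      rw [le_div_iff₀ hi] at h
      linarith
  · have h₁ : t - M * ρ ≤ sSup S := le_csSup hbdd (Set.mem_insert _ _)
    have h₂ : sSup S ≤ t + M * ρ := csSup_le hne hle
    rw [abs_le]
    constructor <;> linarith

/-- Fourier–Motzkin elimination of one real variable. -/
theorem HasHoffmanBound.real_prod {F : Type*} [NormedAddCommGroup F] [NormedSpace ℝ F]
    (hF : HasHoffmanBound F) : HasHoffmanBound (ℝ × F) := by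
  classical
  rintro ι _ a b ⟨⟨t₀, z₀⟩, h₀⟩
  set c : ι → ℝ := fun i => a i (1, 0) with hc
  set a' : ι → F →L[ℝ] ℝ := fun i => (a i).comp (ContinuousLinearMap.inr ℝ ℝ F) with ha'
  have ha : ∀ i t z, a i (t, z) = c i * t + a' i z := fun i t z => by
    have : ((t, z) : ℝ × F) = t • (1, 0) + (0, z) := by simp
    rw [this, map_add, map_smul]
    simp [hc, ha', mul_comm]
  simp only [ha] at h₀
  let a₂ : ι ⊕ ι × ι → F →L[ℝ] ℝ := Sum.elim (fun i => if c i = 0 then a' i else 0)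
    (fun q => if c q.1 < 0 ∧ 0 < c q.2 then c q.2 • a' q.1 - c q.1 • a' q.2 else 0)
  let b₂ : ι ⊕ ι × ι → ℝ := Sum.elim (fun i => if c i = 0 then b i else 0)
    (fun q => if c q.1 < 0 ∧ 0 < c q.2 then c q.2 * b q.1 - c q.1 * b q.2 else 0)
  obtain ⟨K₀, hK₀, hK⟩ := exists_forall_le_of_finite (fun q : ι × ι => c q.2 - c q.1)
  obtain ⟨L, hL, haL⟩ := exists_forall_le_of_finite (fun i => ‖a' i‖)
  obtain ⟨M, hM, hcM⟩ := exists_forall_le_of_finite (fun i => |c i|⁻¹)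
  have helim : ∀ t z r, 0 ≤ r → (∀ i, c i * t + a' i z ≤ b i + r) →
      ∀ q, a₂ q z ≤ b₂ q + (K₀ + 1) * r := by
    rintro t z r hr h (i | ⟨i, j⟩)
    · by_cases hi : c i = 0
      · have := h i
        simp only [hi, zero_mul, zero_add] at this
        simp only [a₂, b₂, Sum.elim_inl, hi, if_true]
        nlinarith
      · simp only [a₂, b₂, Sum.elim_inl, hi, if_false, zero_apply]
        positivity
    · by_cases hij : c i < 0 ∧ 0 < c j
      · simp only [a₂, b₂, Sum.elim_inr, hij, and_self, if_true, sub_apply,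
          smul_apply, smul_eq_mul]
        have h₁ := mul_le_mul_of_nonneg_left (h i) hij.2.le
        have h₂ := mul_le_mul_of_nonneg_left (h j) (neg_nonneg.2 hij.1.le)
        have h₃ := mul_le_mul_of_nonneg_right (hK (i, j)) hr
        dsimp only at h₃
        nlinarith
      · simp only [a₂, b₂, Sum.elim_inr, hij, if_false, zero_apply]
        positivity
  obtain ⟨γ, hγ, hbound⟩ := hF (ι ⊕ ι × ι) a₂ b₂
    ⟨z₀, fun q => by simpa using helim t₀ z₀ 0 le_rfl (by simpa using h₀) q⟩
  set D : ℝ := γ * (K₀ + 1) with hD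
  have hD₀ : 0 ≤ D := by positivity
  refine ⟨max (M * (1 + L * D)) D, le_max_of_le_right hD₀, ?_⟩
  rintro ⟨t, z⟩ r hr hx
  simp only [ha] at hx
  obtain ⟨z', hz', hzz'⟩ := hbound z ((K₀ + 1) * r) (by positivity) (helim t z r hr hx)
  rw [← mul_assoc, ← hD] at hzz'
  obtain ⟨t', ht', htt'⟩ := exists_mul_le_and_abs_sub_le c (fun i => b i - a' i z')
    (t := t) (ρ := (1 + L * D) * r) hM (by positivity) hcM
    (fun i hi => by
      have := hz' (Sum.inl i)
      simp only [a₂, b₂, Sum.elim_inl, hi, if_true] at this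
      linarith)
    (fun i j hi hj => by
      have := hz' (Sum.inr (i, j))
      simp only [a₂, b₂, Sum.elim_inr, hi, hj, and_self, if_true,
        sub_apply, smul_apply, smul_eq_mul] at this
      linarith)
    (fun i => by
      have h₁ : |a' i (z - z')| ≤ L * (D * r) :=
        ((a' i).le_opNorm _).trans (mul_le_mul (haL i) hzz' (norm_nonneg _) hL)
      rw [map_sub] at h₁
      have h₂ := (abs_le.1 h₁).1
      have h₃ := hx i
      linarith)
  refine ⟨(t', z'), fun i => ?_, ?_⟩
  · rw [ha]
    linarith [ht' i]
  · rw [Prod.mk_sub_mk, Prod.norm_mk, max_le_iff]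
    constructor
    · rw [Real.norm_eq_abs]
      refine htt'.trans ?_
      rw [← mul_assoc]
      exact mul_le_mul_of_nonneg_right (le_max_left _ _) hr
    · exact hzz'.trans (mul_le_mul_of_nonneg_right (le_max_right _ _) hr)

theorem HasHoffmanBound.of_equiv {E F : Type*} [NormedAddCommGroup E] [NormedSpace ℝ E]
    [NormedAddCommGroup F] [NormedSpace ℝ F] (e : E ≃L[ℝ] F) (hF : HasHoffmanBound F) :
    HasHoffmanBound E := by
  rintro ι _ a b ⟨x₀, h₀⟩
  obtain ⟨γ, hγ, h⟩ := hF ι (fun i => (a i).comp (e.symm : F →L[ℝ] E)) b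
    ⟨e x₀, fun i => by simpa using h₀ i⟩
  refine ⟨‖(e.symm : F →L[ℝ] E)‖ * γ, by positivity, fun x r hr hx => ?_⟩
  obtain ⟨y, hy, hxy⟩ := h (e x) r hr (fun i => by simpa using hx i)
  refine ⟨e.symm y, fun i => hy i, ?_⟩
  have := (e.symm : F →L[ℝ] E).le_opNorm_of_le hxy
  simpa [mul_assoc] using this

theorem hasHoffmanBound_fin (d : ℕ) : HasHoffmanBound (Fin d → ℝ) := by
  induction d with
  | zero =>
    rintro ι _ a b ⟨x₀, h₀⟩
    exact ⟨0, le_rfl, fun x r _ _ => ⟨x₀, h₀, by simp [Subsingleton.elim x x₀]⟩⟩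
  | succ d ih =>
    have hrank : Module.finrank ℝ (Fin (d + 1) → ℝ) = Module.finrank ℝ (ℝ × (Fin d → ℝ)) := by
      simp [add_comm]
    exact ih.real_prod.of_equiv (ContinuousLinearEquiv.ofFinrankEq hrank)

theorem hasHoffmanBound_of_finiteDimensional (E : Type*) [NormedAddCommGroup E]
    [NormedSpace ℝ E] [FiniteDimensional ℝ E] : HasHoffmanBound E :=
  (hasHoffmanBound_fin (Module.finrank ℝ E)).of_equiv
    (ContinuousLinearEquiv.ofFinrankEq (by simp))

/-- The entry of `tProd A X` at `(i, q, k)` as a continuous linear functional of `X`. -/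
noncomputable def tProdEntry {m l p n : ℕ} [NeZero n] (A : Fin m → Fin l → ZMod n → ℝ)
    (i : Fin m) (q : Fin p) (k : ZMod n) : (Fin l → Fin p → ZMod n → ℝ) →L[ℝ] ℝ :=
  LinearMap.toContinuousLinearMap
    { toFun := fun X => tProd A X i q k
      map_add' := fun X Y => by simp [tProd, mul_add, Finset.sum_add_distrib]
      map_smul' := fun t X => by simp [tProd, Finset.mul_sum, mul_left_comm] }

theorem tfrob_nonneg {a b n : ℕ} [NeZero n] (X : Fin a → Fin b → ZMod n → ℝ) : 0 ≤ tfrob X :=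
  Real.sqrt_nonneg _

theorem abs_apply_le_tfrob {a b n : ℕ} [NeZero n] (X : Fin a → Fin b → ZMod n → ℝ)
    (i : Fin a) (j : Fin b) (k : ZMod n) : |X i j k| ≤ tfrob X := by
  refine Real.abs_le_sqrt ?_
  calc X i j k ^ 2 ≤ ∑ k, X i j k ^ 2 :=
        Finset.single_le_sum (f := fun k => X i j k ^ 2) (fun _ _ => by positivity) (mem_univ k)
    _ ≤ ∑ j, ∑ k, X i j k ^ 2 :=
        Finset.single_le_sum (f := fun j => ∑ k, X i j k ^ 2) (fun _ _ => by positivity)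
          (mem_univ j)
    _ ≤ ∑ i, ∑ j, ∑ k, X i j k ^ 2 :=
        Finset.single_le_sum (f := fun i => ∑ j, ∑ k, X i j k ^ 2) (fun _ _ => by positivity)
          (mem_univ i)

theorem tfrob_le_sqrt_mul_norm {a b n : ℕ} [NeZero n] (X : Fin a → Fin b → ZMod n → ℝ) :
    tfrob X ≤ Real.sqrt (a * (b * n)) * ‖X‖ := by
  refine Real.sqrt_le_iff.2 ⟨by positivity, ?_⟩
  rw [mul_pow, Real.sq_sqrt (by positivity)]
  have h : ∀ i j k, X i j k ^ 2 ≤ ‖X‖ ^ 2 := fun i j k => by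
    rw [← sq_abs, ← Real.norm_eq_abs]
    gcongr
    exact (norm_le_pi_norm (X i j) k).trans
      ((norm_le_pi_norm (X i) j).trans (norm_le_pi_norm X i))
  calc ∑ i, ∑ j, ∑ k, X i j k ^ 2 ≤ ∑ _i : Fin a, ∑ _j : Fin b, ∑ _k : ZMod n, ‖X‖ ^ 2 := by
        exact Finset.sum_le_sum fun i _ => Finset.sum_le_sum fun j _ =>
          Finset.sum_le_sum fun k _ => h i j k
    _ = a * (b * n) * ‖X‖ ^ 2 := by simp [ZMod.card]; ring

theorem tdist_le_tfrob_sub {a b n : ℕ} [NeZero n] (X : Fin a → Fin b → ZMod n → ℝ)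
    {Y : Fin a → Fin b → ZMod n → ℝ} {Ω : Set (Fin a → Fin b → ZMod n → ℝ)} (hY : Y ∈ Ω) :
    tdist X Ω ≤ tfrob (X - Y) :=
  csInf_le ⟨0, by rintro _ ⟨Z, _, rfl⟩; exact tfrob_nonneg _⟩ ⟨Y, hY, rfl⟩

/-- Theorem 4.3: a Hoffman-type bound for tensor linear feasibility systems
under the t-product. -/
theorem hoffman_tensor {m l p n : ℕ} [NeZero n]
    (A : Fin m → Fin l → ZMod n → ℝ) (B : Fin m → Fin p → ZMod n → ℝ)
    (Ile Ieq : Finset (Fin m)) (hdisj : Disjoint Ile Ieq)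
    (hunion : Ile ∪ Ieq = Finset.univ)
    (Ω : Set (Fin l → Fin p → ZMod n → ℝ))
    (hΩ : Ω = {X | (∀ i ∈ Ile, ∀ q k, tProd A X i q k ≤ B i q k) ∧
                   (∀ i ∈ Ieq, ∀ q k, tProd A X i q k = B i q k)})
    (hne : Ω.Nonempty) :
    ∃ γ > 0, ∀ X : Fin l → Fin p → ZMod n → ℝ,
      tdist X Ω ≤ γ * tfrob (fun i q k =>
        if i ∈ Ile then max (tProd A X i q k - B i q k) 0
        else tProd A X i q k - B i q k) := by
  classical
  subst hΩ
  let a : (Fin m × Fin p × ZMod n) ⊕ (Ieq × Fin p × ZMod n) →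
      (Fin l → Fin p → ZMod n → ℝ) →L[ℝ] ℝ :=
    Sum.elim (fun e => tProdEntry A e.1 e.2.1 e.2.2) (fun e => -tProdEntry A e.1 e.2.1 e.2.2)
  let b : (Fin m × Fin p × ZMod n) ⊕ (Ieq × Fin p × ZMod n) → ℝ :=
    Sum.elim (fun e => B e.1 e.2.1 e.2.2) (fun e => -B e.1 e.2.1 e.2.2)
  have hmem : ∀ i, i ∈ Ile ∨ i ∈ Ieq := fun i => by
    rw [← Finset.mem_union, hunion]
    exact Finset.mem_univ i
  obtain ⟨X₀, hle, heq⟩ := hne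
  obtain ⟨γ, hγ, h⟩ := hasHoffmanBound_of_finiteDimensional (Fin l → Fin p → ZMod n → ℝ) _ a b
    ⟨X₀, by
      rintro (⟨i, q, k⟩ | ⟨⟨i, hi⟩, q, k⟩)
      · exact (hmem i).elim (fun hi => hle i hi q k) (fun hi => (heq i hi q k).le)
      · exact neg_le_neg (heq i hi q k).ge⟩
  refine ⟨Real.sqrt (l * (p * n)) * γ + 1, by positivity, fun X => ?_⟩
  set R : Fin m → Fin p → ZMod n → ℝ := fun i q k =>
    if i ∈ Ile then max (tProd A X i q k - B i q k) 0 else tProd A X i q k - B i q k with hR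
  have hr := tfrob_nonneg R
  obtain ⟨Y, hY, hXY⟩ := h X (tfrob R) hr (by
    rintro (⟨i, q, k⟩ | ⟨⟨i, hi⟩, q, k⟩)
    · have h₁ : tProd A X i q k - B i q k ≤ R i q k := by
        simp only [hR]
        split_ifs
        exacts [le_max_left _ _, le_rfl]
      have h₂ := (le_abs_self _).trans (abs_apply_le_tfrob R i q k)
      change tProd A X i q k ≤ B i q k + tfrob R
      linarith
    · have h₁ : R i q k = tProd A X i q k - B i q k :=
        if_neg (Finset.disjoint_right.1 hdisj hi)
      have h₂ := (neg_le_abs _).trans (abs_apply_le_tfrob R i q k)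
      change -tProd A X i q k ≤ -B i q k + tfrob R
      linarith)
  have hYle : ∀ i q k, tProd A Y i q k ≤ B i q k := fun i q k => hY (Sum.inl (i, q, k))
  have hYeq : ∀ i ∈ Ieq, ∀ q k, tProd A Y i q k = B i q k := fun i hi q k =>
    le_antisymm (hYle i q k) (neg_le_neg_iff.1 (hY (Sum.inr (⟨i, hi⟩, q, k))))
  refine (tdist_le_tfrob_sub X (Set.mem_ofPred.2 ⟨fun i _ => hYle i, hYeq⟩)).trans ?_
  calc tfrob (X - Y) ≤ Real.sqrt (l * (p * n)) * ‖X - Y‖ := tfrob_le_sqrt_mul_norm _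
    _ ≤ Real.sqrt (l * (p * n)) * (γ * tfrob R) := by gcongr
    _ ≤ (Real.sqrt (l * (p * n)) * γ + 1) * tfrob R := by linarith
end

section
/- Let 𝒜 be a real tensor of size m×l×n and 𝒳 a real tensor of size l×p×n. Then ‖𝒜∗𝒳‖_F ≤ (max_{k ∈ ZMod n} ‖Â_k‖₂)·‖𝒳‖_F, where ‖Â_k‖₂ denotes the L2 operator norm (largest singular value) of the complex m×l matrix Â_k. -/
open Finset

/-- The `k`-th frontal slice of the discrete Fourier transform of a tensor. -/
noncomputable def dftSlice {m l n : ℕ} [NeZero n]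
    (A : Fin m → Fin l → ZMod n → ℝ) (k : ZMod n) : Matrix (Fin m) (Fin l) ℂ :=
  Matrix.of fun i j => ∑ s : ZMod n, (A i j s : ℂ) *
    Complex.exp (-2 * (Real.pi : ℂ) * Complex.I * (k.val : ℂ) * (s.val : ℂ) / (n : ℂ))

/-- The `L2` operator norm (largest singular value) of a complex matrix. -/
noncomputable def l2OpNorm {a b : ℕ} (M : Matrix (Fin a) (Fin b) ℂ) : ℝ :=
  ‖LinearMap.toContinuousLinearMap (Matrix.toEuclideanLin M)‖

open scoped ZMod ComplexConjugate

/-- Parseval's identity for the discrete Fourier transform on `ZMod n`. -/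
lemma sum_norm_sq_dft {n : ℕ} [NeZero n] (f : ZMod n → ℂ) :
    ∑ k, ‖𝓕 f k‖ ^ 2 = n * ∑ j, ‖f j‖ ^ 2 := by
  have key : ∑ k, conj (𝓕 f k) * 𝓕 f k = n * ∑ j, conj (f j) * f j := by
    calc ∑ k, conj (𝓕 f k) * 𝓕 f k
        = ∑ k, ∑ j, conj (f j) * (ZMod.stdAddChar (j * k) * 𝓕 f k) := by
          refine sum_congr rfl fun k _ => ?_
          nth_rw 1 [ZMod.dft_apply]
          rw [map_sum, sum_mul]
          refine sum_congr rfl fun j _ => ?_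
          rw [smul_eq_mul, map_mul, ← AddChar.map_neg_eq_conj, neg_neg]
          ring
      _ = ∑ j, conj (f j) * 𝓕 (𝓕 f) (-j) := by
          rw [sum_comm]
          refine sum_congr rfl fun j _ => ?_
          rw [ZMod.dft_apply (𝓕 f), mul_sum]
          refine sum_congr rfl fun k _ => ?_
          rw [smul_eq_mul, mul_neg, neg_neg, mul_comm k j]
      _ = n * ∑ j, conj (f j) * f j := by
          rw [ZMod.dft_dft, mul_sum]
          refine sum_congr rfl fun j _ => ?_
          simp only [neg_neg, smul_eq_mul]
          ring
  simp only [Complex.conj_mul'] at key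
  exact_mod_cast key

/-- The discrete Fourier transform turns convolution into multiplication. -/
lemma dft_convolution {n : ℕ} [NeZero n] (f g : ZMod n → ℂ) (k : ZMod n) :
    𝓕 (fun t => ∑ s, f s * g (t - s)) k = 𝓕 f k * 𝓕 g k := by
  simp only [ZMod.dft_apply, smul_eq_mul, mul_sum, sum_mul]
  rw [sum_comm]
  conv_rhs => rw [sum_comm]
  refine sum_congr rfl fun s _ => ?_
  rw [← Equiv.sum_comp (Equiv.addRight s)]
  refine sum_congr rfl fun t _ => ?_
  rw [Equiv.coe_addRight, add_sub_cancel_right, add_mul, neg_add, AddChar.map_add_eq_mul]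
  ring

lemma dftSlice_apply {m l n : ℕ} [NeZero n] (A : Fin m → Fin l → ZMod n → ℝ)
    (k : ZMod n) (i : Fin m) (j : Fin l) :
    dftSlice A k i j = 𝓕 (fun s => (A i j s : ℂ)) k := by
  rw [dftSlice, Matrix.of_apply, ZMod.dft_apply]
  refine sum_congr rfl fun s _ => ?_
  have h : -(s * k) = ((-(k.val * s.val : ℤ) : ℤ) : ZMod n) := by
    push_cast
    rw [ZMod.natCast_zmod_val, ZMod.natCast_zmod_val, mul_comm]
  rw [h, ZMod.stdAddChar_coe, smul_eq_mul, mul_comm]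
  push_cast
  ring_nf

lemma dftSlice_tProd {m l p n : ℕ} [NeZero n]
    (A : Fin m → Fin l → ZMod n → ℝ) (X : Fin l → Fin p → ZMod n → ℝ) (k : ZMod n) :
    dftSlice (tProd A X) k = dftSlice A k * dftSlice X k := by
  ext i q
  have h : (fun t => (tProd A X i q t : ℂ)) =
      ∑ j, fun t => ∑ s, (A i j s : ℂ) * (X j q (t - s) : ℂ) := by
    ext t
    simp [tProd]
  simp only [Matrix.mul_apply, dftSlice_apply]
  rw [h, map_sum, Finset.sum_apply]
  exact sum_congr rfl fun j _ =>
    dft_convolution (fun s => (A i j s : ℂ)) (fun s => (X j q s : ℂ)) k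

/-- Parseval's identity for tensors. -/
lemma sum_norm_sq_dftSlice {a b n : ℕ} [NeZero n] (X : Fin a → Fin b → ZMod n → ℝ) :
    ∑ k, ∑ j, ∑ i, ‖dftSlice X k i j‖ ^ 2 = n * tfrob X ^ 2 := by
  rw [tfrob, Real.sq_sqrt (by positivity), sum_comm, sum_comm (s := (univ : Finset (Fin a))),
    mul_sum]
  refine sum_congr rfl fun j _ => ?_
  rw [sum_comm, mul_sum]
  refine sum_congr rfl fun i _ => ?_
  simp only [dftSlice_apply, sum_norm_sq_dft, Complex.norm_real, Real.norm_eq_abs, sq_abs]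

/-- The Frobenius norm of a product is controlled by the `L2` operator norm of the left factor. -/
lemma sum_norm_sq_mul_le {a b c : ℕ} (M : Matrix (Fin a) (Fin b) ℂ)
    (Y : Matrix (Fin b) (Fin c) ℂ) :
    ∑ q, ∑ i, ‖(M * Y) i q‖ ^ 2 ≤ l2OpNorm M ^ 2 * ∑ q, ∑ j, ‖Y j q‖ ^ 2 := by
  rw [mul_sum]
  refine sum_le_sum fun q _ => ?_
  have h := (LinearMap.toContinuousLinearMap (Matrix.toEuclideanLin M)).le_opNorm
    (WithLp.toLp 2 fun j => Y j q)
  have h2 := pow_le_pow_left₀ (norm_nonneg _) h 2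
  rw [mul_pow, EuclideanSpace.norm_sq_eq, EuclideanSpace.norm_sq_eq] at h2
  exact h2

/-- Lemma 4.4: `‖𝒜∗𝒳‖_F ≤ (max_k ‖Â_k‖₂)·‖𝒳‖_F`. -/
theorem tprod_frob_le {m l p n : ℕ} [NeZero n]
    (A : Fin m → Fin l → ZMod n → ℝ) (X : Fin l → Fin p → ZMod n → ℝ) :
    tfrob (tProd A X) ≤
      (Finset.univ.sup' ⟨0, Finset.mem_univ (0 : ZMod n)⟩
        fun k => l2OpNorm (dftSlice A k)) * tfrob X := by
  set c := Finset.univ.sup' ⟨0, Finset.mem_univ (0 : ZMod n)⟩ fun k => l2OpNorm (dftSlice A k)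
  have hle (k : ZMod n) : l2OpNorm (dftSlice A k) ≤ c :=
    le_sup' (fun k => l2OpNorm (dftSlice A k)) (mem_univ k)
  have hnn (k : ZMod n) : 0 ≤ l2OpNorm (dftSlice A k) := norm_nonneg _
  refine (sq_le_sq₀ (Real.sqrt_nonneg _)
    (mul_nonneg ((hnn 0).trans (hle 0)) (Real.sqrt_nonneg _))).1 ?_
  have hn : (0 : ℝ) < n := Nat.cast_pos.2 (NeZero.pos n)
  refine le_of_mul_le_mul_left ?_ hn
  calc (n : ℝ) * tfrob (tProd A X) ^ 2
      = ∑ k, ∑ q, ∑ i, ‖(dftSlice A k * dftSlice X k) i q‖ ^ 2 := by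
        simp only [← sum_norm_sq_dftSlice, dftSlice_tProd]
    _ ≤ ∑ k, c ^ 2 * ∑ q, ∑ j, ‖dftSlice X k j q‖ ^ 2 := by
        refine sum_le_sum fun k _ => (sum_norm_sq_mul_le _ _).trans ?_
        gcongr
        exacts [hnn k, hle k]
    _ = n * (c * tfrob X) ^ 2 := by
        rw [← mul_sum, sum_norm_sq_dftSlice]
        ring
end
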